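/- arXiv:2402.14507 — 2 statements merged into one kernel-verified Lean document; each statement's English description precedes it below -/
import Mathlib

section
/- Let G be a group and let C, H be subgroups of G with [C, H] ≤ H. Suppose that C^{(N)}(H) ≤ γ₂(H) for some integer N ≥ 1. Then C^{(Nn − n + 1)}(γ_n(H)) ≤ γ_{n+1}(H) for every integer n ≥ 1. -/
/-- Iterated commutator subgroups: `C⁽⁰⁾(H) = H`, `C⁽ⁿ⁺¹⁾(H) = ⁅C, C⁽ⁿ⁾(H)⁆`. -/
def iterComm {G : Type*} [Group G] (C H : Subgroup G) : ℕ → Subgroup G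
  | 0 => H
  | n + 1 => ⁅C, iterComm C H n⁆

/-- The lower central series of a subgroup `H` of `G`, viewed inside `G`:
`lcsIn H 0 = H = γ₁(H)` and `lcsIn H n = γ_{n+1}(H)`. -/
def lcsIn {G : Type*} [Group G] (H : Subgroup G) : ℕ → Subgroup G
  | 0 => H
  | n + 1 => ⁅H, lcsIn H n⁆

namespace IterCommAux

open Subgroup

variable {G : Type*} [Group G]

lemma comm_le_iff (X Y D : Subgroup G) [D.Normal] :
    ⁅X, Y⁆ ≤ D ↔ ⁅X.map (QuotientGroup.mk' D), Y.map (QuotientGroup.mk' D)⁆ = ⊥ := by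
  rw [← map_commutator, Subgroup.map_eq_bot_iff, QuotientGroup.ker_mk']

lemma three (X Y Z D : Subgroup G) [D.Normal] (h1 : ⁅⁅Y, Z⁆, X⁆ ≤ D) (h2 : ⁅⁅Z, X⁆, Y⁆ ≤ D) :
    ⁅⁅X, Y⁆, Z⁆ ≤ D := by
  rw [comm_le_iff, map_commutator] at *
  exact commutator_commutator_eq_bot_of_rotate h1 h2

/-- The left multipliers: elements commuting with `X` modulo `D`. -/
lemma le_centr_iff (X Y D : Subgroup G) [D.Normal] :
    ⁅X, Y⁆ ≤ D ↔
      Y ≤ (centralizer (X.map (QuotientGroup.mk' D) : Set (G ⧸ D))).comap (QuotientGroup.mk' D) := by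
  rw [commutator_comm, comm_le_iff, commutator_eq_bot_iff_le_centralizer, map_le_iff_le_comap]

lemma comm_sup_le {X Y Z D : Subgroup G} [D.Normal] (h1 : ⁅X, Y⁆ ≤ D) (h2 : ⁅X, Z⁆ ≤ D) :
    ⁅X, Y ⊔ Z⁆ ≤ D := by
  rw [le_centr_iff] at *
  exact sup_le h1 h2

lemma comm_iSup_le {ι : Type*} {X D : Subgroup G} {Y : ι → Subgroup G} [D.Normal]
    (h : ∀ i, ⁅X, Y i⁆ ≤ D) : ⁅X, ⨆ i, Y i⁆ ≤ D := by
  rw [le_centr_iff]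
  exact iSup_le fun i => (le_centr_iff _ _ _).1 (h i)

lemma normal_of {C H K : Subgroup G} (hT : C ⊔ H = ⊤) (h1 : ⁅C, K⁆ ≤ K) (h2 : ⁅H, K⁆ ≤ K) :
    K.Normal := by
  rw [← normalizer_eq_top_iff, eq_top_iff, ← hT]
  exact sup_le (le_normalizer_iff_commutator_le_right.2 h1)
    (le_normalizer_iff_commutator_le_right.2 h2)

/-- The filtration of `K` over `L`. -/
def filt (C K L : Subgroup G) : ℕ → Subgroup G
  | 0 => K
  | k + 1 => ⁅C, filt C K L k⁆ ⊔ L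

lemma filt_anti_succ {C K L : Subgroup G} [K.Normal] (hL : L ≤ K) (k : ℕ) :
    filt C K L (k + 1) ≤ filt C K L k := by
  induction k with
  | zero => exact sup_le (commutator_le_right C K) hL
  | succ k ih => exact sup_le_sup_right (commutator_mono le_rfl ih) _

lemma filt_anti {C K L : Subgroup G} [K.Normal] (hL : L ≤ K) : Antitone (filt C K L) :=
  antitone_nat_of_succ_le (filt_anti_succ hL)

lemma le_filt {C K L : Subgroup G} (hL : L ≤ K) (k : ℕ) : L ≤ filt C K L k := by
  cases k with
  | zero => exact hL
  | succ k => exact le_sup_right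

lemma filt_normal {C H K L : Subgroup G} [K.Normal] (hT : C ⊔ H = ⊤) (hL : L ≤ K)
    (hK : ⁅H, K⁆ ≤ L) (k : ℕ) : (filt C K L k).Normal := by
  refine normal_of hT ?_ ?_
  · exact le_sup_left.trans (filt_anti_succ hL k)
  · exact ((commutator_mono le_rfl (filt_anti hL (Nat.zero_le k))).trans hK).trans (le_filt hL k)

lemma iter_le_filt (C K L : Subgroup G) (k : ℕ) : iterComm C K k ≤ filt C K L k := by
  induction k with
  | zero => exact le_rfl
  | succ k ih => exact (commutator_mono le_rfl ih).trans le_sup_left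

lemma filt_le_iter {C H K L : Subgroup G} [K.Normal] [L.Normal] (hT : C ⊔ H = ⊤) (hL : L ≤ K)
    (hK : ⁅H, K⁆ ≤ L) (k : ℕ) : iterComm C K k ≤ K ∧ filt C K L k ≤ iterComm C K k ⊔ L := by
  have hle : ∀ k, iterComm C K k ≤ K := fun k =>
    (iter_le_filt C K L k).trans (filt_anti hL (Nat.zero_le k))
  have hanti : ∀ k, iterComm C K (k + 1) ≤ iterComm C K k := by
    intro k
    induction k with
    | zero => exact commutator_le_right C K
    | succ k ih => exact commutator_mono le_rfl ih
  refine ⟨hle k, ?_⟩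
  induction k with
  | zero => exact le_sup_left
  | succ k ih =>
    refine sup_le ?_ le_sup_right
    refine (commutator_mono le_rfl ih).trans ?_
    have : (iterComm C K (k + 1) ⊔ L).Normal := by
      refine normal_of hT ?_ ?_
      · have hc : ⁅C, iterComm C K (k + 1)⁆ ≤ iterComm C K (k + 1) := hanti (k + 1)
        rw [← le_normalizer_iff_commutator_le_right] at hc ⊢
        refine (le_inf hc ?_).trans (normalizer_inf_normalizer_le_normalizer_sup _ _)
        rw [normalizer_eq_top]
        exact le_top
      · exact ((commutator_mono le_rfl (sup_le (hle _) hL)).trans hK).trans le_sup_right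
    exact comm_sup_le le_sup_left ((commutator_le_right _ _).trans le_sup_right)

lemma lcs_normal {H : Subgroup G} [H.Normal] (m : ℕ) : (lcsIn H m).Normal := by
  induction m with
  | zero => assumption
  | succ m ih => exact commutator_normal _ _

lemma lcs_succ_le {H : Subgroup G} [H.Normal] (m : ℕ) : lcsIn H (m + 1) ≤ lcsIn H m :=
  have := lcs_normal (H := H) m
  commutator_le_right _ _

lemma key {C H : Subgroup G} [H.Normal] (hT : C ⊔ H = ⊤) (M : ℕ)
    (hbase : iterComm C H (M + 1) ≤ lcsIn H 1) (m : ℕ) :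
    filt C (lcsIn H m) (lcsIn H (m + 1)) ((m + 1) * M + 1) ≤ lcsIn H (m + 1) := by
  have hn := lcs_normal (H := H)
  have hs := lcs_succ_le (H := H)
  have h0 : filt C H (lcsIn H 1) (M + 1) ≤ lcsIn H 1 :=
    (filt_le_iter hT (hs 0) le_rfl (M + 1)).2.trans (sup_le hbase le_rfl)
  induction m with
  | zero => simpa [lcsIn] using h0
  | succ m ih =>
    set A := filt C H (lcsIn H 1) with hA
    set B := filt C (lcsIn H m) (lcsIn H (m + 1)) with hB
    have hAn : ∀ i, (A i).Normal := filt_normal hT (hs 0) le_rfl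
    have hBn : ∀ i, (B i).Normal := filt_normal hT (hs m) le_rfl
    have hAa : Antitone A := filt_anti (hs 0)
    have hBa : Antitone B := filt_anti (hs m)
    let S : ℕ → Subgroup G := fun k => ⨆ p : {p : ℕ × ℕ // p.1 + p.2 = k}, ⁅A p.1.1, B p.1.2⁆
    let P : ℕ → Subgroup G := fun k => S k ⊔ lcsIn H (m + 2)
    have hPle : ∀ i j k, i + j = k → ⁅A i, B j⁆ ≤ P k := fun i j k h =>
      (le_iSup (fun p : {p : ℕ × ℕ // p.1 + p.2 = k} => ⁅A p.1.1, B p.1.2⁆) ⟨(i, j), h⟩).trans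
        le_sup_left
    have h2 : ⁅lcsIn H 1, lcsIn H m⁆ ≤ lcsIn H (m + 2) := by
      refine three _ _ _ _ ?_ ?_
      · rw [commutator_comm]; exact le_rfl
      · rw [commutator_comm, commutator_comm _ H]; exact le_rfl
    have hSn : ∀ k, (S k).Normal := fun k => iSup_normal _
    have hPn : ∀ k, (P k).Normal := fun k => sup_normal _ _
    have hA1 : ∀ i, ⁅C, A i⁆ ≤ A (i + 1) := fun i => le_sup_left
    have hB1 : ∀ i, ⁅C, B i⁆ ≤ B (i + 1) := fun i => le_sup_left
    have hstep : ∀ k, ⁅C, P k⁆ ≤ P (k + 1) := by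
      intro k
      refine comm_sup_le (comm_iSup_le ?_) ((commutator_le_right _ _).trans le_sup_right)
      rintro ⟨⟨i, j⟩, h⟩
      dsimp only at h ⊢
      rw [commutator_comm]
      refine three _ _ _ _ ?_ ?_
      · rw [commutator_comm, commutator_comm _ C]
        exact (commutator_mono le_rfl (hB1 j)).trans (hPle _ _ _ (by omega))
      · exact (commutator_mono (hA1 i) le_rfl).trans (hPle _ _ _ (by omega))
    have hF : ∀ k, filt C (lcsIn H (m + 1)) (lcsIn H (m + 2)) k ≤ P k := by
      intro k
      induction k with
      | zero => exact hPle 0 0 0 rfl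
      | succ k ihk => exact sup_le ((commutator_mono le_rfl ihk).trans (hstep k)) le_sup_right
    refine (hF _).trans (sup_le (iSup_le ?_) le_rfl)
    rintro ⟨⟨i, j⟩, h⟩
    dsimp only at h ⊢
    by_cases hi : M + 1 ≤ i
    · exact (commutator_mono ((hAa hi).trans h0) (hBa (Nat.zero_le j))).trans h2
    · have hj : (m + 1) * M + 1 ≤ j := by
        have : (m + 1 + 1) * M = (m + 1) * M + M := by ring
        omega
      exact commutator_mono (hAa (Nat.zero_le i)) ((hBa hj).trans ih)

lemma map_iter {G' : Type*} [Group G'] (f : G →* G') (C H : Subgroup G) (k : ℕ) :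
    (iterComm C H k).map f = iterComm (C.map f) (H.map f) k := by
  induction k with
  | zero => rfl
  | succ k ih => simp only [iterComm, map_commutator, ih]

lemma map_lcs {G' : Type*} [Group G'] (f : G →* G') (H : Subgroup G) (k : ℕ) :
    (lcsIn H k).map f = lcsIn (H.map f) k := by
  induction k with
  | zero => rfl
  | succ k ih => simp only [lcsIn, map_commutator, ih]

end IterCommAux

/-- Let `C, H ≤ G` with `[C, H] ≤ H` and `C⁽ᴺ⁾(H) ≤ γ₂(H)` for some
`N ≥ 1`. Then `C⁽ᴺⁿ⁻ⁿ⁺¹⁾(γₙ(H)) ≤ γₙ₊₁(H)` for every `n ≥ 1`. -/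
theorem iterComm_lcs_le
    {G : Type*} [Group G] (C H : Subgroup G)
    (hCH : ⁅C, H⁆ ≤ H) (N : ℕ) (hN : 1 ≤ N)
    (hbase : iterComm C H N ≤ lcsIn H 1) :
    ∀ n : ℕ, 1 ≤ n → iterComm C (lcsIn H (n - 1)) (N * n - n + 1) ≤ lcsIn H n := by
  intro n hn
  obtain ⟨m, rfl⟩ : ∃ m, n = m + 1 := ⟨n - 1, by omega⟩
  obtain ⟨M, rfl⟩ : ∃ M, N = M + 1 := ⟨N - 1, by omega⟩
  have e : (M + 1) * (m + 1) - (m + 1) + 1 = (m + 1) * M + 1 := by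
    have : (M + 1) * (m + 1) = (m + 1) * M + (m + 1) := by ring
    omega
  rw [e, Nat.add_sub_cancel]
  let T : Subgroup G := C ⊔ H
  let f : T →* G := T.subtype
  have hf : Function.Injective f := T.subtype_injective
  have hC : (C.subgroupOf T).map f = C := Subgroup.map_subgroupOf_eq_of_le le_sup_left
  have hH : (H.subgroupOf T).map f = H := Subgroup.map_subgroupOf_eq_of_le le_sup_right
  have hHn : (H.subgroupOf T).Normal := by
    apply Subgroup.normal_subgroupOf_of_le_normalizer
    exact sup_le (Subgroup.le_normalizer_iff_commutator_le_right.2 hCH) Subgroup.le_normalizer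
  have hT : C.subgroupOf T ⊔ H.subgroupOf T = ⊤ := by
    rw [← Subgroup.subgroupOf_sup le_sup_left le_sup_right]
    exact Subgroup.subgroupOf_self T
  have hb : iterComm (C.subgroupOf T) (H.subgroupOf T) (M + 1) ≤ lcsIn (H.subgroupOf T) 1 := by
    rw [← Subgroup.map_le_map_iff_of_injective hf, IterCommAux.map_iter, IterCommAux.map_lcs,
      hC, hH]
    exact hbase
  have hk := (IterCommAux.iter_le_filt _ _ _ _).trans (IterCommAux.key hT M hb m)
  rw [← Subgroup.map_le_map_iff_of_injective hf, IterCommAux.map_iter, IterCommAux.map_lcs,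
    IterCommAux.map_lcs, hC, hH] at hk
  exact hk
end

section
/- Let P = V₁ * V₂ be the free product of two copies of the additive group (ℚ,+), with canonical homomorphisms ι₁, ι₂ : (ℚ,+) → P. There exists a group homomorphism ψ : P → G with ψ(ι₁(a)) = [x₁(a), x₂(1)] and ψ(ι₂(a)) = [x₂(a), x₃(1)] for all a ∈ ℚ, and any such homomorphism ψ is injective. In other words, the subgroups [U₁, U₂] ≅ ℚ and [U₂, U₃] ≅ ℚ of G generate their free product ℚ * ℚ. -/
/-- The commutator `[g, h] = g⁻¹h⁻¹gh`. -/
def pComm {G : Type*} [Group G] (g h : G) : G := g⁻¹ * h⁻¹ * g * h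

/-- The free product `F = U₁ * U₂ * U₃` of three copies of `(ℚ, +)`. -/
abbrev FreeProdQ3 : Type := Monoid.CoprodI (fun _ : Fin 3 => Multiplicative ℚ)

/-- The canonical homomorphisms `xᵢ : (ℚ, +) → F`. -/
def xF (i : Fin 3) : Multiplicative ℚ →* FreeProdQ3 :=
  Monoid.CoprodI.of (M := fun _ : Fin 3 => Multiplicative ℚ) (i := i)

/-- The defining relators `[xᵢ(a), [xᵢ(b), xⱼ(c)]]` for `i ≠ j`. -/
def relsA2t : Set FreeProdQ3 :=
  {g | ∃ (i j : Fin 3) (a b c : ℚ), i ≠ j ∧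
    g = pComm (xF i (Multiplicative.ofAdd a))
          (pComm (xF i (Multiplicative.ofAdd b)) (xF j (Multiplicative.ofAdd c)))}

/-- The Kac–Moody–Steinberg group `G = 𝒰_{Ã₂}(ℚ)`. -/
abbrev UA2t : Type := FreeProdQ3 ⧸ Subgroup.normalClosure relsA2t

/-- The induced homomorphisms `xᵢ : (ℚ, +) → G`. -/
def xG (i : Fin 3) : Multiplicative ℚ →* UA2t :=
  (QuotientGroup.mk' (Subgroup.normalClosure relsA2t)).comp (xF i)

namespace KMS
open Classical

/-- Points of the Heisenberg group over `ℚ`, in symmetric coordinates. -/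
@[ext] structure HH where
  p : ℚ
  q : ℚ
  z : ℚ

def one : HH := ⟨0, 0, 0⟩

/-- central element -/
def cen (s : ℚ) : HH := ⟨0, 0, s⟩

/-- right multiplication by the root element in direction `d` -/
def m (d : Bool) (a : ℚ) (h : HH) : HH :=
  if d then ⟨h.p, h.q + a, h.z + a * h.p⟩ else ⟨h.p + a, h.q, h.z - a * h.q⟩

def co (d : Bool) (h : HH) : ℚ := if d then h.q else h.p

def sg (d : Bool) : ℚ := if d then 1 else -1

/-- `KK d h = 0` iff `h ∈ U_d U_{!d}` -/
def KK (d : Bool) (h : HH) : ℚ := h.z + sg d * co d h * co (!d) h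

lemma m_m (d a b h) : m d a (m d b h) = m d (b + a) h := by
  cases d <;> simp [m] <;> constructor <;> ring
lemma m_zero (d h) : m d 0 h = h := by
  cases d <;> simp [m]
lemma co_m_same (d a h) : co d (m d a h) = co d h + a := by
  cases d <;> simp [m, co]
lemma co_m_not (d a h) : co (!d) (m d a h) = co (!d) h := by
  cases d <;> simp [m, co]
lemma co_m_not' (d a h) : co d (m (!d) a h) = co d h := by
  cases d <;> simp [m, co]
lemma sg_ne (d) : sg d ≠ 0 := by cases d <;> simp [sg]
lemma sg_not (d) : sg (!d) = - sg d := by cases d <;> simp [sg]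
lemma KK_m_not (d a h) : KK d (m (!d) a h) = KK d h := by
  cases d <;> simp [m, co, KK, sg] <;> ring
lemma KK_m_not' (d a h) : KK (!d) (m d a h) = KK (!d) h := by
  cases d <;> simp [m, co, KK, sg] <;> ring
lemma KK_m_same (d a h) : KK d (m d a h) = KK d h + 2 * sg d * a * co (!d) h := by
  cases d <;> simp [m, co, KK, sg] <;> ring
lemma co_one (d) : co d one = 0 := by cases d <;> simp [co, one]
lemma KK_one (d) : KK d one = 0 := by cases d <;> simp [co, one, KK]
lemma co_cen (d s) : co d (cen s) = 0 := by cases d <;> simp [co, cen]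
lemma KK_cen (d s) : KK d (cen s) = s := by cases d <;> simp [co, cen, KK]

/-- elements of `U_d U_{!d}` -/
lemma eq_of_KK {d h} (hk : KK d h = 0) : h = m (!d) (co (!d) h) (m d (co d h) one) := by
  cases d <;> simp [KK, co, sg] at hk <;> ext <;> simp [m, co, one] <;> linarith

lemma eq_of_KK' {d h} (hk : KK (!d) h = 0) : h = m d (co d h) (m (!d) (co (!d) h) one) := by
  have := eq_of_KK hk
  simpa using this

inductive VV where
  | o : VV
  | S : VV → Bool → HH → VV
  | D : VV → HH → ℚ → (Bool → VV) → (Bool → HH) → VV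

abbrev FF := VV × HH

def act (d : Bool) (a : ℚ) (f : FF) : FF := (f.1, m d a f.2)

lemma act_act (d a b f) : act d a (act d b f) = act d (b + a) f := by
  simp [act, m_m]
lemma act_zero (d f) : act d 0 f = f := by simp [act, m_zero]

/-- flags already known at a vertex -/
def NN : VV → Set HH
  | .o => ∅
  | .S _ e _ => {g | KK (!e) g = 0}
  | .D _ _ _ _ _ => {g | ∃ d, KK d g = 0}

noncomputable def ext (v : VV) (N : Set HH) (near : Bool → HH → FF) (d : Bool) (h : HH) : FF :=
  if H : ∃ a, m d a h ∈ N then act (!d) (-H.choose) (near d (m d H.choose h))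
  else (.S v d (m d (-co d h) h), m (!d) (co d h) one)

noncomputable def C0 (v : VV) (h : HH) (l : ℚ) (t : Bool → HH → FF) : FF :=
  if l = 0 then (v, h) else (.D v h l (fun d => (t d h).1) (fun d => (t d h).2), one)

noncomputable def T : VV → Bool → HH → FF
  | .o => ext .o ∅ (fun _ h => (.o, h))
  | .S v e h0 => ext (.S v e h0) (NN (.S v e h0)) (fun d g =>
      if d = e then act (!e) (co e g) (T v (!e) (m e (co (!e) g) h0))
      else C0 v (m e (co (!e) g) h0) (co e g) (T v))
  | .D v h l w g => ext (.D v h l w g) (NN (.D v h l w g)) (fun d k =>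
      if co (!d) k = 0 then (w d, m (!d) (co d k) (m d l (g d)))
      else if KK (!d) k = 0 then
        act (!d) (co d k) (T (w (!d)) (!d) (m d (co (!d) k) (m (!d) l (g (!d)))))
      else C0 (w d) (m (!d) (co d k) (m d l (g d))) (co (!d) k) (T (w d)))

noncomputable def near : VV → Bool → HH → FF
  | .o => (fun _ h => (.o, h))
  | .S v e h0 => (fun d g =>
      if d = e then act (!e) (co e g) (T v (!e) (m e (co (!e) g) h0))
      else C0 v (m e (co (!e) g) h0) (co e g) (T v))
  | .D _ _ l w g => (fun d k =>
      if co (!d) k = 0 then (w d, m (!d) (co d k) (m d l (g d)))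
      else if KK (!d) k = 0 then
        act (!d) (co d k) (T (w (!d)) (!d) (m d (co (!d) k) (m (!d) l (g (!d)))))
      else C0 (w d) (m (!d) (co d k) (m d l (g d))) (co (!d) k) (T (w d)))

lemma T_eq (v) : T v = ext v (NN v) (near v) := by
  cases v <;> rfl

lemma near_compat (v d b h) (h1 : h ∈ NN v) (h2 : m d b h ∈ NN v) :
    near v d (m d b h) = act (!d) b (near v d h) := by
  cases v with
  | o => exact absurd h1 (by simp [NN])
  | S v e h0 =>
    simp only [NN, Set.mem_ofPred_eq] at h1 h2
    simp only [near]
    by_cases hde : d = e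
    · subst hde
      simp [co_m_same, co_m_not, act_act]
    · have : e = !d := by cases d <;> cases e <;> simp_all
      subst this
      simp only [Bool.not_not] at *
      rw [KK_m_same, h1] at h2
      simp only [hde, if_false, co_m_not, co_m_same]
      have : b = 0 ∨ co (!d) h = 0 := by
        have := sg_ne d
        simpa [this] using h2
      rcases this with rfl | h3
      · simp [act_zero]
      · simp [h3, C0, act, m_m]
  | D v h0 l w g =>
    simp only [NN, Set.mem_ofPred_eq] at h1 h2
    simp only [near, co_m_not, co_m_same, KK_m_not']
    split_ifs with h3 h4
    · simp [act, m_m]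
    · simp [act_act]
    · have k1 : KK d h = 0 := by
        obtain ⟨e, he⟩ := h1
        cases d <;> cases e <;> simp_all
      have k2 : KK d (m d b h) = 0 := by
        obtain ⟨e, he⟩ := h2
        by_cases hde : e = d
        · rwa [hde] at he
        · have : e = !d := by cases d <;> cases e <;> simp_all
          subst this
          rw [KK_m_not'] at he
          exact absurd he h4
      rw [KK_m_same, k1] at k2
      have : b = 0 := by
        have := sg_ne d
        simpa [this, h3] using k2
      subst this
      simp [act_zero]

lemma T_near {v h} (d) (hN : h ∈ NN v) : T v d h = near v d h := by
  have H : ∃ a, m d a h ∈ NN v := ⟨0, by rwa [m_zero]⟩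
  rw [T_eq, ext, dif_pos H, near_compat _ _ _ _ hN H.choose_spec, act_act]
  simp [act_zero]

lemma T_of_mem {v h a} (d) (hN : m d a h ∈ NN v) :
    T v d h = act (!d) (-a) (near v d (m d a h)) := by
  have H : ∃ a, m d a h ∈ NN v := ⟨a, hN⟩
  rw [T_eq, ext, dif_pos H]
  have : m d H.choose h = m d (H.choose - a) (m d a h) := by rw [m_m]; congr 1; ring
  have h2 := near_compat v d (H.choose - a) (m d a h) hN (this ▸ H.choose_spec)
  rw [this, h2, act_act]
  congr 1; ring

lemma T_far {v h} (d) (hN : ∀ a, m d a h ∉ NN v) :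
    T v d h = (.S v d (m d (-co d h) h), m (!d) (co d h) one) := by
  rw [T_eq, ext, dif_neg (by simpa using hN)]

lemma T_compat (v d b h) : T v d (m d b h) = act (!d) b (T v d h) := by
  by_cases H : ∃ a, m d a h ∈ NN v
  · obtain ⟨a, ha⟩ := H
    have h1 : m d (a - b) (m d b h) = m d a h := by rw [m_m]; congr 1; ring
    rw [T_of_mem d ha, T_of_mem (a := a - b) d (by rwa [h1]), h1, act_act]
    congr 1; ring
  · push Not at H
    rw [T_far d H, T_far d (fun a => by rw [m_m]; exact H _)]
    simp [act, m_m, co_m_same]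

/-- Analysis of non-far outer flags. -/
lemma nonfar {v h d a} (h0 : h ∉ NN v) (h1 : m d a h ∈ NN v) :
    a ≠ 0 ∧ co (!d) h ≠ 0 ∧ KK d (m d a h) = 0 ∧
    ((∃ v' x, v = .S v' (!d) x) ∨ (KK (!d) h ≠ 0 ∧ ∃ v' x l w g, v = .D v' x l w g)) := by
  have ha : a ≠ 0 := by rintro rfl; rw [m_zero] at h1; exact h0 h1
  refine ⟨ha, ?_⟩
  cases v with
  | o => exact absurd h1 (by simp [NN])
  | S v e x =>
    simp only [NN, Set.mem_ofPred_eq] at h1 h0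
    by_cases hde : d = e
    · subst hde
      rw [KK_m_not'] at h1; exact absurd h1 h0
    · have : e = !d := by cases d <;> cases e <;> simp_all
      subst this
      simp only [Bool.not_not] at *
      refine ⟨?_, h1, Or.inl ⟨_, _, rfl⟩⟩
      intro hc
      rw [KK_m_same, hc] at h1
      simp at h1; exact h0 h1
  | D v x l w g =>
    simp only [NN, Set.mem_ofPred_eq, not_exists] at h1 h0
    have k : KK d (m d a h) = 0 := by
      obtain ⟨e, he⟩ := h1
      by_cases hde : e = d
      · rwa [hde] at he
      · have : e = !d := by cases d <;> cases e <;> simp_all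
        subst this
        rw [KK_m_not'] at he
        exact absurd he (h0 _)
    refine ⟨?_, k, Or.inr ⟨h0 _, _, _, _, _, _, rfl⟩⟩
    intro hc
    rw [KK_m_same, hc] at k
    simp at k; exact h0 _ k

def Valid : VV → Prop
  | .o => True
  | .S v d h => Valid v ∧ co d h = 0 ∧ ∀ a, m d a h ∉ NN v
  | .D v h l w g => Valid v ∧ h ∉ NN v ∧ l ≠ 0 ∧ ∀ d, T v d h = (w d, g d)

/-- the new vertex above a boundary edge -/
noncomputable def Dv (v : VV) (h : HH) (l : ℚ) : VV :=
  .D v h l (fun d => (T v d h).1) (fun d => (T v d h).2)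

lemma C0_ne {v h l} (hl : l ≠ 0) : C0 v h l (T v) = (Dv v h l, one) := by
  simp [C0, hl, Dv]

lemma C0_zero {v h} : C0 v h 0 (T v) = (v, h) := by
  simp [C0]

lemma T_nonfar {v h d a} (h0 : h ∉ NN v) (h1 : m d a h ∈ NN v) :
    a ≠ 0 ∧ ∃ v1 h1 u, u ≠ 0 ∧ T v d h = act (!d) (-a) (Dv v1 h1 u, one) ∧
     m (!d) u (m d (co d (m d a h)) one) = m d a h ∧
     ((∃ x, v = .S v1 (!d) x ∧ h1 = m (!d) (co d (m d a h)) x) ∨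
      (∃ v' x l w g, v = .D v' x l w g ∧ v1 = w d ∧ co d (m d a h) ≠ 0 ∧
        h1 = m (!d) (co d (m d a h)) (m d l (g d)))) := by
  obtain ⟨ha, hc, hk, H⟩ := nonfar h0 h1
  refine ⟨ha, ?_⟩
  rw [T_of_mem d h1]
  have e1 := (eq_of_KK hk).symm
  rw [co_m_not] at e1
  obtain ⟨v', x, rfl⟩ | ⟨hk2, v', x, l, w, g, rfl⟩ := H
  · refine ⟨v', m (!d) (co d (m d a h)) x, co (!d) h, hc, ?_, e1, Or.inl ⟨x, rfl, rfl⟩⟩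
    simp only [near]
    rw [if_neg (by cases d <;> simp), Bool.not_not, co_m_not, C0_ne hc]
  · refine ⟨w d, m (!d) (co d (m d a h)) (m d l (g d)), co (!d) h, hc, ?_, e1,
      Or.inr ⟨_, _, _, _, _, rfl, rfl, ?_, rfl⟩⟩
    · simp only [near]
      rw [co_m_not, if_neg hc, KK_m_not', if_neg hk2, C0_ne hc]
    · intro h3
      apply hk2
      rw [← KK_m_not' d a, ← e1, h3, m_zero, KK_m_same, KK_one, co_one]
      simp [co_one]

lemma shape {v h} (d) (h0 : h ∉ NN v) : ∃ w s, T v d h = (w, m (!d) s one) ∧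
    ((∃ v' x, w = .S v' d x) ∨ (s ≠ 0 ∧ ∃ v' x l w' g, w = .D v' x l w' g)) := by
  by_cases H : ∃ a, m d a h ∈ NN v
  · obtain ⟨a, h1⟩ := H
    obtain ⟨ha, v1, h1, u, hu, hT, -⟩ := T_nonfar h0 h1
    exact ⟨_, -a, hT, Or.inr ⟨neg_ne_zero.2 ha, _, _, _, _, _, rfl⟩⟩
  · push Not at H
    rw [T_far d H]
    exact ⟨_, _, rfl, Or.inl ⟨_, _, rfl⟩⟩

lemma outerD {v h d l a} (h0 : h ∉ NN v) (hl : l ≠ 0) (ha : a ≠ 0) :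
    m (!d) a (m d l (T v d h).2) ∉ NN (T v d h).1 := by
  obtain ⟨w, s, hT, hw⟩ := shape d h0
  rw [hT]
  have k1 : KK (!d) (m (!d) a (m d l (m (!d) s one))) ≠ 0 := by
    rw [KK_m_same, KK_m_not']
    have := KK_m_same (!d) s one
    simp only [Bool.not_not, KK_one, co_one] at this ⊢
    rw [this, co_m_same, co_m_not']
    have := sg_ne (!d)
    simp [co_one, *]
  have k2 : s ≠ 0 → KK d (m (!d) a (m d l (m (!d) s one))) ≠ 0 := by
    intro hs
    rw [KK_m_not, KK_m_same, KK_m_not, KK_one, co_m_same]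
    have := sg_ne d
    simp [co_one, *]
  rcases hw with ⟨v', x, rfl⟩ | ⟨hs, v', x, l, w, g, rfl⟩
  · simpa [NN] using k1
  · simp only [NN, Set.mem_ofPred_eq, not_exists]
    intro e
    by_cases hde : e = d
    · rw [hde]; exact k2 hs
    · have : e = !d := by cases d <;> cases e <;> simp_all
      rw [this]; exact k1


lemma near_D_first {v h l w g a} (e b) (ha : a ≠ 0) :
    near (.D v h l w g) e (m (!e) b (m e a one)) =
      C0 (w e) (m (!e) a (m e l (g e))) b (T (w e)) ∧
    near (.D v h l w g) (!e) (m (!e) b (m e a one)) =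
      act e b (T (w e) e (m (!e) a (m e l (g e)))) := by
  have c1 : co e (m (!e) b (m e a one)) = a := by
    rw [co_m_not', co_m_same, co_one, zero_add]
  have c2 : co (!e) (m (!e) b (m e a one)) = b := by
    rw [co_m_same, co_m_not, co_one, zero_add]
  have k1 : KK e (m (!e) b (m e a one)) = 0 := by
    rw [KK_m_not, KK_m_same, KK_one, co_one]; simp
  have k2 : KK (!e) (m (!e) b (m e a one)) = 2 * sg (!e) * b * a := by
    rw [KK_m_same, KK_m_not', KK_one, Bool.not_not, co_m_same, co_one]; simp
  have := sg_ne (!e)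
  constructor
  · simp only [near, c1, c2, k2]
    by_cases hb : b = 0
    · simp [hb, C0]
    · simp [hb, ha, this]
  · simp only [near, Bool.not_not, c1, c2, k1, if_true]
    simp [ha]

lemma mem_NN_D {v h l w g e a b} : m (!e) b (m e a one) ∈ NN (.D v h l w g) := by
  simp only [NN, Set.mem_ofPred_eq]
  refine ⟨e, ?_⟩
  rw [KK_m_not, KK_m_same, KK_one, co_one]; simp

lemma mem_NN_S {v h e a b} : m e b (m (!e) a one) ∈ NN (.S v e h) := by
  simp only [NN, Set.mem_ofPred_eq]
  rw [KK_m_not', KK_m_same, KK_one, co_one]; simp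

lemma near_S {v h} (e a b) :
    near (.S v e h) (!e) (m e b (m (!e) a one)) = C0 v (m e a h) b (T v) ∧
    near (.S v e h) e (m e b (m (!e) a one)) = act (!e) b (T v (!e) (m e a h)) := by
  have c1 : co e (m e b (m (!e) a one)) = b := by
    rw [co_m_same, co_m_not', co_one, zero_add]
  have c2 : co (!e) (m e b (m (!e) a one)) = a := by
    rw [co_m_not, co_m_same, co_one, zero_add]
  constructor
  · simp only [near, c1, c2]
    rw [if_neg (by cases e <;> simp)]
  · simp only [near, c1, c2, if_true]

lemma key {v h d a v1 h1 u a0 l} (ha : a ≠ 0)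
    (hT : T v d h = act (!d) (-a) (Dv v1 h1 u, one))
    (hu : m (!d) u (m d a0 one) = m d a h)
    (h1 : T v1 (!d) h1 = (v, m d a0 one)) :
    m d l (T v d h).2 ∈ NN (T v d h).1 ∧
    near (T v d h).1 (!d) (m d l (T v d h).2) = C0 v h l (T v) ∧
    near (T v d h).1 d (m d l (T v d h).2) = act (!d) l (T v (!d) h) := by
  rw [hT]
  simp only [act, Dv]
  have := fun v' h' l' w' g' => near_D_first (v := v') (h := h') (l := l') (w := w') (g := g')
    (!d) l (neg_ne_zero.2 ha)
  simp only [Bool.not_not] at this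
  refine ⟨?_, ?_, ?_⟩
  · have := @mem_NN_D
    specialize @this v1 (by assumption) u (fun d => (T v1 d (by assumption)).1) (fun d => (T v1 d (by assumption)).2) (!d) (-a) l
    simpa using this
  · rw [(this _ _ _ _ _).1, h1]
    simp only
    rw [hu, m_m]; simp [m_zero]
  · rw [(this _ _ _ _ _).2, h1]
    simp only
    rw [hu, m_m]; simp [m_zero, act]

lemma claimA : ∀ v, Valid v → ∀ h, h ∉ NN v → ∀ d l,
    m d l (T v d h).2 ∈ NN (T v d h).1 ∧
    near (T v d h).1 (!d) (m d l (T v d h).2) = C0 v h l (T v) ∧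
    near (T v d h).1 d (m d l (T v d h).2) = act (!d) l (T v (!d) h) := by
  intro v
  induction v with
  | o =>
    intro hv h h0 d l
    rw [T_far d (by simp [NN])]
    refine ⟨mem_NN_S, ?_, ?_⟩
    · rw [(near_S _ _ _).1, m_m]; simp [m_zero]
    · rw [(near_S _ _ _).2, m_m]; simp [m_zero]
  | S v' e x ih =>
    intro hv h h0 d l
    by_cases H : ∃ a, m d a h ∈ NN (.S v' e x)
    · obtain ⟨a, ha⟩ := H
      obtain ⟨ha0, v1, h1, u, hu, hT, hm, ⟨y, hy, rfl⟩ | ⟨_, _, _, _, _, hy, _⟩⟩ := T_nonfar h0 ha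
      · cases hy
        refine key ha0 hT hm ?_
        obtain ⟨hv1, hx, hf⟩ := hv
        rw [T_compat, T_far _ hf, hx]
        simp [act, m_zero]
      · cases hy
    · push Not at H
      rw [T_far d H]
      refine ⟨mem_NN_S, ?_, ?_⟩
      · rw [(near_S _ _ _).1, m_m]; simp [m_zero]
      · rw [(near_S _ _ _).2, m_m]; simp [m_zero]
  | D v' x l' w g ih _ =>
    intro hv h h0 d l
    by_cases H : ∃ a, m d a h ∈ NN (.D v' x l' w g)
    · obtain ⟨a, ha⟩ := H
      obtain ⟨ha0, v1, h1, u, hu, hT, hm, ⟨y, hy, _⟩ | ⟨_, _, _, _, _, hy, rfl, hc, rfl⟩⟩ :=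
        T_nonfar h0 ha
      · cases hy
      · cases hy
        refine key ha0 hT hm ?_
        obtain ⟨hv1, hx, hl, hwg⟩ := hv
        obtain ⟨i1, i2, i3⟩ := ih hv1 x hx d l'
        rw [hwg d] at i1 i2 i3
        rw [T_compat, T_near _ i1, i2, C0_ne hl]
        simp only [act, Bool.not_not, Dv, hwg]
    · push Not at H
      rw [T_far d H]
      refine ⟨mem_NN_S, ?_, ?_⟩
      · rw [(near_S _ _ _).1, m_m]; simp [m_zero]
      · rw [(near_S _ _ _).2, m_m]; simp [m_zero]

lemma valid_Dv {v h l} (hv : Valid v) (h0 : h ∉ NN v) (hl : l ≠ 0) : Valid (Dv v h l) :=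
  ⟨hv, h0, hl, fun _ => rfl⟩

lemma valid_T_outer : ∀ v, Valid v → ∀ h, h ∉ NN v → ∀ d, Valid (T v d h).1 := by
  intro v
  have far : ∀ v, Valid v → ∀ h d, (¬ ∃ a, m d a h ∈ NN v) → Valid (T v d h).1 := by
    intro v hv h d H
    push Not at H
    rw [T_far d H]
    refine ⟨hv, by simp [co_m_same], fun a => ?_⟩
    rw [m_m]; exact H _
  induction v with
  | o =>
    intro hv h h0 d
    exact far _ hv _ _ (by simp [NN])
  | S v' e x ih =>
    intro hv h h0 d
    by_cases H : ∃ a, m d a h ∈ NN (.S v' e x)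
    · obtain ⟨a, ha⟩ := H
      obtain ⟨ha0, v1, h1, u, hu, hT, hm, ⟨y, hy, rfl⟩ | ⟨_, _, _, _, _, hy, _⟩⟩ := T_nonfar h0 ha
      · cases hy
        rw [hT]
        exact valid_Dv hv.1 (hv.2.2 _) hu
      · cases hy
    · exact far _ hv _ _ H
  | D v' x l' w g ih _ =>
    intro hv h h0 d
    by_cases H : ∃ a, m d a h ∈ NN (.D v' x l' w g)
    · obtain ⟨a, ha⟩ := H
      obtain ⟨ha0, v1, h1, u, hu, hT, hm, ⟨y, hy, _⟩ | ⟨_, _, _, _, _, hy, rfl, hc, rfl⟩⟩ :=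
        T_nonfar h0 ha
      · cases hy
      · cases hy
        rw [hT]
        obtain ⟨hv1, hx, hl, hwg⟩ := hv
        have := ih hv1 x hx d
        have h3 := outerD (d := d) hx hl hc
        rw [hwg d] at this h3
        exact valid_Dv this h3 hu
    · exact far _ hv _ _ H

/-- the three flags of a chamber -/
noncomputable def c0 (v : VV) (h : HH) (l : ℚ) : FF := C0 v h l (T v)
noncomputable def c1 (v : VV) (h : HH) (l : ℚ) (d : Bool) : FF := act d l (T v d h)

lemma valid_c0 {v h} (l) (hv : Valid v) (h0 : h ∉ NN v) : Valid (c0 v h l).1 := by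
  by_cases hl : l = 0
  · subst hl; rw [c0, C0_zero]; exact hv
  · rw [c0, C0_ne hl]; exact valid_Dv hv h0 hl

lemma valid_c1 {v h} (l d) (hv : Valid v) (h0 : h ∉ NN v) : Valid (c1 v h l d).1 :=
  valid_T_outer v hv h h0 d

noncomputable def TT (d : Bool) (f : FF) : FF := T f.1 d f.2

lemma TT_act (d b f) : TT d (act d b f) = act (!d) b (TT d f) := T_compat _ _ _ _

lemma TT_c0 {v h} (l d) : TT d (c0 v h l) = c1 v h l d := by
  by_cases hl : l = 0
  · subst hl; rw [c0, C0_zero, c1, act_zero]; rfl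
  · rw [c0, C0_ne hl, TT]
    have : one ∈ NN (Dv v h l) := by
      simp only [NN, Dv, Set.mem_ofPred_eq]
      exact ⟨true, KK_one _⟩
    simp only
    rw [T_near _ this]
    simp [Dv, near, co_one, m_zero, c1, act]

lemma TT_c1 {v h} (l d) (hv : Valid v) (h0 : h ∉ NN v) :
    TT (!d) (c1 v h l d) = c0 v h l ∧ TT d (c1 v h l d) = c1 v h l (!d) := by
  obtain ⟨i1, i2, i3⟩ := claimA v hv h h0 d l
  refine ⟨?_, ?_⟩
  · rw [TT, c1, act]; simp only
    rw [T_near _ i1, i2]; rfl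
  · rw [TT, c1, act]; simp only
    rw [T_near _ i1, i3]; rfl

lemma exists_chamber (f : FF) (hf : Valid f.1) : ∃ v h l, Valid v ∧ h ∉ NN v ∧
    (f = c0 v h l ∨ ∃ d, f = c1 v h l d) := by
  obtain ⟨v, h⟩ := f
  simp only at hf
  by_cases h0 : h ∈ NN v
  swap
  · exact ⟨v, h, 0, hf, h0, Or.inl (by rw [c0, C0_zero])⟩
  cases v with
  | o => exact absurd h0 (by simp [NN])
  | S v' e x =>
    obtain ⟨hv, hx, hfar⟩ := hf
    refine ⟨v', m e (co (!e) h) x, co e h, hv, hfar _, Or.inr ⟨e, ?_⟩⟩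
    rw [c1, T_compat, T_far _ hfar, hx]
    simp only [NN, Set.mem_ofPred_eq] at h0
    have := eq_of_KK' h0
    simp only [act, m_zero, neg_zero]
    rw [← this]
  | D v' x l w g =>
    have hf' := hf
    obtain ⟨hv, hx, hl, hwg⟩ := hf
    have hD : VV.D v' x l w g = Dv v' x l := by simp [Dv, hwg]
    obtain ⟨e, he⟩ := h0
    have main : ∀ e a b, a ≠ 0 → h = m (!e) b (m e a one) → ∃ v h' l', Valid v ∧ h' ∉ NN v ∧
        ((VV.D v' x l w g, h) = c0 v h' l' ∨ ∃ d, (VV.D v' x l w g, h) = c1 v h' l' d) := by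
      intro e a b ha hh
      have o := outerD (d := e) hx hl ha
      have hw := valid_T_outer v' hv x hx e
      refine ⟨_, _, b, hw, o, Or.inr ⟨!e, ?_⟩⟩
      obtain ⟨i1, i2, i3⟩ := claimA v' hv x hx e l
      rw [c1, T_compat, T_near _ i1, i2, C0_ne hl, hD, hh]
      simp [act]
    have hh := eq_of_KK he
    by_cases ha : co e h = 0
    · by_cases hb : co (!e) h = 0
      · refine ⟨v', x, l, hv, hx, Or.inl ?_⟩
        rw [c0, C0_ne hl, hD, hh, ha, hb, m_zero, m_zero]
      · refine main (!e) (co (!e) h) 0 hb ?_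
        rw [ha, m_zero] at hh
        rw [m_zero]; exact hh
    · exact main e _ _ ha hh

lemma valid_TT {f : FF} (d) (hf : Valid f.1) : Valid (TT d f).1 := by
  obtain ⟨v, h, l, hv, h0, rfl | ⟨e, rfl⟩⟩ := exists_chamber f hf
  · rw [TT_c0]; exact valid_c1 _ _ hv h0
  · have := TT_c1 l e hv h0
    by_cases hde : d = e
    · rw [hde, this.2]; exact valid_c1 _ _ hv h0
    · have h2 : d = !e := by cases d <;> cases e <;> simp_all
      rw [h2, this.1]; exact valid_c0 _ hv h0

lemma TT_inv {f : FF} (d) (hf : Valid f.1) : TT (!d) (TT d f) = f := by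
  obtain ⟨v, h, l, hv, h0, rfl | ⟨e, rfl⟩⟩ := exists_chamber f hf
  · rw [TT_c0, (TT_c1 l d hv h0).1]
  · have := TT_c1 l e hv h0
    have t2 := TT_c1 l (!e) hv h0
    by_cases hde : d = e
    · rw [hde, this.2, t2.2, Bool.not_not]
    · have h2 : d = !e := by cases d <;> cases e <;> simp_all
      rw [h2, this.1, TT_c0, Bool.not_not]

lemma TT_sq {f : FF} (d) (hf : Valid f.1) : TT d (TT d f) = TT (!d) f := by
  obtain ⟨v, h, l, hv, h0, rfl | ⟨e, rfl⟩⟩ := exists_chamber f hf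
  · rw [TT_c0, (TT_c1 l d hv h0).2, TT_c0]
  · have := TT_c1 l e hv h0
    have t2 := TT_c1 l (!e) hv h0
    simp only [Bool.not_not] at t2
    by_cases hde : d = e
    · rw [hde, this.2, t2.1, this.1]
    · have h2 : d = !e := by cases d <;> cases e <;> simp_all
      rw [h2, this.1, TT_c0, Bool.not_not, this.2]

end KMS

namespace KMS

abbrev FV := {f : FF // Valid f.1}

/-- translation permutation in direction `d` -/
def Pm (d : Bool) : Multiplicative ℚ →* Equiv.Perm FV where
  toFun a :=
    { toFun := fun f => ⟨act d a.toAdd f.1, f.2⟩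
      invFun := fun f => ⟨act d (-a.toAdd) f.1, f.2⟩
      left_inv := fun f => by ext1; simp [act_act, act_zero]
      right_inv := fun f => by ext1; simp [act_act, act_zero] }
  map_one' := by ext1 f; simp [act_zero]
  map_mul' a b := by
    ext1 f
    apply Subtype.ext
    simp [act_act, add_comm]

noncomputable def Tp : Equiv.Perm FV where
  toFun f := ⟨TT true f.1, valid_TT _ f.2⟩
  invFun f := ⟨TT false f.1, valid_TT _ f.2⟩
  left_inv f := Subtype.ext (TT_inv true f.2)
  right_inv f := Subtype.ext (TT_inv false f.2)

def shiftH (s : ℚ) (h : HH) : HH := ⟨h.p, h.q, h.z + s⟩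

def Sh (s : ℚ) : Equiv.Perm FV where
  toFun f := ⟨(f.1.1, shiftH s f.1.2), f.2⟩
  invFun f := ⟨(f.1.1, shiftH (-s) f.1.2), f.2⟩
  left_inv f := by simp [shiftH]
  right_inv f := by simp [shiftH]

lemma comm_XY (d : Bool) (a b : Multiplicative ℚ) :
    pComm (Pm d a) (Pm (!d) b) = Sh (2 * sg d * a.toAdd * b.toAdd) := by
  unfold pComm
  rw [← map_inv, ← map_inv]
  ext1 f
  apply Subtype.ext
  obtain ⟨⟨v, h⟩, hf⟩ := f
  cases d <;> simp [Pm, Sh, act, m, shiftH, sg] <;> ring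

lemma Sh_comm (d a s) : pComm (Pm d a) (Sh s) = 1 := by
  have : Pm d a * Sh s = Sh s * Pm d a := by
    ext1 f
    apply Subtype.ext
    obtain ⟨⟨v, h⟩, hf⟩ := f
    cases d <;> simp [Pm, Sh, act, m, shiftH] <;> ring
  unfold pComm
  rw [mul_assoc, this]; group

lemma relPm (d a b c) : pComm (Pm d a) (pComm (Pm d b) (Pm (!d) c)) = 1 := by
  rw [comm_XY, Sh_comm]

lemma pComm_map {G H : Type*} [Group G] [Group H] (f : G →* H) (a b : G) :
    f (pComm a b) = pComm (f a) (f b) := by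
  simp [pComm]

lemma TpY (a) : Tp * Pm true a * Tp⁻¹ = Pm false a := by
  rw [mul_inv_eq_iff_eq_mul]
  ext1 f
  exact Subtype.ext (TT_act true _ f.1)

lemma Tp_sq : Tp * Tp = Tp⁻¹ := by
  ext1 f
  exact Subtype.ext (TT_sq true f.2)

/-- the three root group actions -/
noncomputable def xP : Fin 3 → (Multiplicative ℚ →* Equiv.Perm FV)
  | 0 => Pm false
  | 1 => Pm true
  | 2 => (MulAut.conj Tp⁻¹).toMonoidHom.comp (Pm true)

lemma conj_xP (i : Fin 3) (a) : MulAut.conj Tp (xP (i + 1) a) = xP i a := by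
  fin_cases i
  · simp [xP, MulAut.conj_apply, TpY]
  · simp [xP, MulAut.conj_apply, mul_assoc]
  · change Tp * Pm false a * Tp⁻¹ = Tp⁻¹ * Pm true a * (Tp⁻¹)⁻¹
    rw [← TpY]
    calc Tp * (Tp * Pm true a * Tp⁻¹) * Tp⁻¹ = (Tp * Tp) * Pm true a * (Tp * Tp)⁻¹ := by
          simp only [mul_assoc, mul_inv_rev]
      _ = _ := by rw [Tp_sq]

lemma rel_step (i j : Fin 3)
    (h : ∀ a b c, pComm (xP i a) (pComm (xP i b) (xP j c)) = 1) (a b c) :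
    pComm (xP (i + 1) a) (pComm (xP (i + 1) b) (xP (j + 1) c)) = 1 := by
  apply (MulAut.conj Tp).injective
  have := fun x y => pComm_map (MulAut.conj Tp).toMonoidHom x y
  simp only [MulEquiv.toMonoidHom_eq_coe, MonoidHom.coe_coe] at this
  rw [this, this, conj_xP, conj_xP, conj_xP, h, map_one]

lemma relxP (i j : Fin 3) (hij : i ≠ j) (a b c) :
    pComm (xP i a) (pComm (xP i b) (xP j c)) = 1 := by
  have h01 := relPm false
  have h10 := relPm true
  have h12 := rel_step 0 1 h01
  have h21 := rel_step 1 0 h10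
  have h20 := rel_step _ _ h12
  have h02 := rel_step _ _ h21
  fin_cases i <;> fin_cases j <;> first | exact absurd rfl hij | skip
  · exact h01 a b c
  · exact h02 a b c
  · exact h10 a b c
  · exact h12 a b c
  · exact h20 a b c
  · exact h21 a b c

noncomputable def phi : UA2t →* Equiv.Perm FV :=
  QuotientGroup.lift _ (Monoid.CoprodI.lift xP) (by
    change Subgroup.normalClosure relsA2t ≤ MonoidHom.ker _
    apply Subgroup.normalClosure_le_normal
    rintro g ⟨i, j, a, b, c, hij, rfl⟩
    change Monoid.CoprodI.lift xP _ = 1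
    rw [pComm_map, pComm_map]
    simp only [xF, Monoid.CoprodI.lift_of]
    exact relxP i j hij _ _ _)

lemma phi_x (i a) : phi (xG i a) = xP i a := by
  simp [phi, xG, xF, QuotientGroup.lift_mk']

/-- images of the two factors -/
noncomputable def ff : Bool → (Multiplicative ℚ →* Equiv.Perm FV) :=
  let A : Multiplicative ℚ →* Equiv.Perm FV :=
    { toFun := fun a => Sh (-2 * a.toAdd)
      map_one' := by ext1 f; simp [Sh, shiftH]
      map_mul' := fun a b => by
        ext1 f; apply Subtype.ext; simp [Sh, shiftH]; ring }
  fun d => if d then (MulAut.conj Tp⁻¹).toMonoidHom.comp A else A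

lemma ff_false (a) : ff false a = Sh (-2 * a.toAdd) := rfl
lemma ff_true (a) : ff true a = Tp⁻¹ * Sh (-2 * a.toAdd) * Tp := by
  simp [ff, MulAut.conj_apply]

def Q (v : VV) : Prop := v = .o ∨ ∃ v' x, v = .S v' false x

lemma T_cen {v s} (d) (hs : s ≠ 0) (hv : v = .o ∨ ∃ v' x, v = .S v' (!d) x) :
    TT d (v, cen s) = (.S v d (cen s), one) := by
  have : ∀ a, m d a (cen s) ∉ NN v := by
    intro a
    rcases hv with rfl | ⟨v', x, rfl⟩
    · simp [NN]
    · simp only [NN, Set.mem_ofPred_eq, Bool.not_not]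
      rw [KK_m_same, KK_cen, co_cen]; simpa using hs
  rw [TT, T_far _ this]
  simp [co_cen, m_zero]

def XX : Bool → Set FV
  | false => {f | ∃ v s, s ≠ 0 ∧ Q v ∧ f.1 = (v, cen s)}
  | true => {f | ∃ v x, f.1 = (.S v false x, one)}

lemma shift_one (s) : shiftH s one = cen s := by simp [shiftH, one, cen]

lemma lift_inj : Function.Injective (Monoid.CoprodI.lift ff) := by
  have key1 : ∀ (f : FV) s, s ≠ 0 → f ∈ XX true → Sh s f ∈ XX false := by
    rintro ⟨f, hf⟩ s hs ⟨v, x, rfl⟩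
    refine ⟨_, s, hs, Or.inr ⟨v, x, rfl⟩, ?_⟩
    simp [Sh, shift_one]
  have key2 : ∀ (f : FV) s, s ≠ 0 → f ∈ XX false → (Tp⁻¹ * Sh s * Tp) f ∈ XX true := by
    rintro ⟨f, hf⟩ s hs ⟨v, t, ht, hv, rfl⟩
    have e1 : (Tp ⟨(v, cen t), hf⟩).1 = (.S v true (cen t), one) := T_cen true ht hv
    have e2 : (Sh s (Tp ⟨(v, cen t), hf⟩)).1 = (.S v true (cen t), cen s) := by
      simp [Sh, e1, shift_one]
    refine ⟨.S v true (cen t), cen s, ?_⟩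
    change TT false (Sh s (Tp ⟨(v, cen t), hf⟩)).1 = _
    rw [e2]
    exact T_cen false hs (Or.inr ⟨_, _, rfl⟩)
  have b0 : (⟨(.o, cen 1), trivial⟩ : FV) ∈ XX false :=
    ⟨_, 1, one_ne_zero, Or.inl rfl, rfl⟩
  have hne : ∀ a : Multiplicative ℚ, a ≠ 1 → -2 * a.toAdd ≠ 0 := by
    intro a ha h
    apply ha
    have : a.toAdd = 0 := by linarith
    exact toAdd_eq_zero.1 this
  refine Monoid.CoprodI.lift_injective_of_ping_pong ff ?_ XX ?_ ?_ ?_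
  · right
    refine ⟨true, ?_⟩
    exact (Cardinal.natCast_lt_aleph0 (n := 3)).le.trans (Cardinal.aleph0_le_mk _)
  · rintro (_ | _)
    · exact ⟨_, b0⟩
    · exact ⟨_, key2 _ 1 one_ne_zero b0⟩
  · have : Disjoint (XX false) (XX true) := by
      rw [Set.disjoint_left]
      rintro f ⟨v, s, hs, -, h1⟩ ⟨v', x, h2⟩
      rw [h1] at h2
      simp [cen, one, hs] at h2
    rintro (_ | _) (_ | _) h
    · exact absurd rfl h
    · exact this
    · exact this.symm
    · exact absurd rfl h
  · rintro (_ | _) (_ | _) h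
    · exact absurd rfl h
    · rintro a ha _ ⟨f, hf, rfl⟩
      simp only [ff_false]
      exact key1 _ _ (hne a ha) hf
    · rintro a ha _ ⟨f, hf, rfl⟩
      simp only [ff_true]
      exact key2 _ _ (hne a ha) hf
    · exact absurd rfl h

/-- the comparison of binary and indexed free products -/
def toI : Monoid.Coprod (Multiplicative ℚ) (Multiplicative ℚ) →*
    Monoid.CoprodI (fun _ : Bool => Multiplicative ℚ) :=
  Monoid.Coprod.lift (Monoid.CoprodI.of (M := fun _ : Bool => Multiplicative ℚ) (i := false))
    (Monoid.CoprodI.of (M := fun _ : Bool => Multiplicative ℚ) (i := true))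

lemma toI_inj : Function.Injective toI := by
  let r : Monoid.CoprodI (fun _ : Bool => Multiplicative ℚ) →*
      Monoid.Coprod (Multiplicative ℚ) (Multiplicative ℚ) :=
    Monoid.CoprodI.lift (fun b => if b then Monoid.Coprod.inr else Monoid.Coprod.inl)
  have : r.comp toI = MonoidHom.id _ := by
    apply Monoid.Coprod.hom_ext <;> ext a <;> simp [r, toI]
  intro a b h
  have h2 := congrArg r h
  have e := fun x => DFunLike.congr_fun this x
  simp only [MonoidHom.comp_apply, MonoidHom.id_apply] at e
  rwa [e, e] at h2

lemma rel_G (i j : Fin 3) (hij : i ≠ j) (a b c : ℚ) :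
    Commute (xG i (.ofAdd a)) (pComm (xG i (.ofAdd b)) (xG j (.ofAdd c))) := by
  have h : pComm (xG i (.ofAdd a)) (pComm (xG i (.ofAdd b)) (xG j (.ofAdd c))) = 1 := by
    simp only [xG, MonoidHom.comp_apply]
    rw [← pComm_map, ← pComm_map]
    exact (QuotientGroup.eq_one_iff _).2 (Subgroup.subset_normalClosure ⟨i, j, a, b, c, hij, rfl⟩)
  generalize xG i (.ofAdd a) = x at *
  generalize pComm (xG i (.ofAdd b)) (xG j (.ofAdd c)) = y at *
  unfold pComm at h
  have h2 : x⁻¹ * y⁻¹ * x * y = (y * x)⁻¹ * (x * y) := by group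
  rw [h2, inv_mul_eq_one] at h
  exact h.symm

/-- `a ↦ [xᵢ(a), xⱼ(1)]` as a homomorphism -/
def cHom (i j : Fin 3) (hij : i ≠ j) : Multiplicative ℚ →* UA2t where
  toFun a := pComm (xG i a) (xG j (.ofAdd 1))
  map_one' := by simp [pComm]
  map_mul' a b := by
    have h : xG i b * pComm (xG i a) (xG j (.ofAdd 1)) =
      pComm (xG i a) (xG j (.ofAdd 1)) * xG i b := rel_G i j hij b.toAdd a.toAdd 1
    rw [map_mul]
    generalize xG i a = x at *
    generalize xG i b = x' at *
    generalize xG j (.ofAdd 1) = y at *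
    have e : pComm (x * x') y = x'⁻¹ * pComm x y * x' * pComm x' y := by unfold pComm; group
    rw [e, mul_assoc x'⁻¹, ← h]; group

end KMS

/-- Let `P = V₁ * V₂` be the free product of two copies of `(ℚ, +)`.
There exists a homomorphism `ψ : P → 𝒰_{Ã₂}(ℚ)` with `ψ(ι₁(a)) = [x₁(a), x₂(1)]` and
`ψ(ι₂(a)) = [x₂(a), x₃(1)]`, and every such homomorphism is injective: the subgroups
`[U₁, U₂] ≅ ℚ` and `[U₂, U₃] ≅ ℚ` generate their free product `ℚ * ℚ` in `𝒰_{Ã₂}(ℚ)`. -/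
theorem commutator_subgroups_generate_free_product :
    (∃ ψ : Monoid.Coprod (Multiplicative ℚ) (Multiplicative ℚ) →* UA2t,
      (∀ a : ℚ, ψ (Monoid.Coprod.inl (Multiplicative.ofAdd a)) =
        pComm (xG 0 (Multiplicative.ofAdd a)) (xG 1 (Multiplicative.ofAdd 1))) ∧
      (∀ a : ℚ, ψ (Monoid.Coprod.inr (Multiplicative.ofAdd a)) =
        pComm (xG 1 (Multiplicative.ofAdd a)) (xG 2 (Multiplicative.ofAdd 1)))) ∧
    (∀ ψ : Monoid.Coprod (Multiplicative ℚ) (Multiplicative ℚ) →* UA2t,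
      (∀ a : ℚ, ψ (Monoid.Coprod.inl (Multiplicative.ofAdd a)) =
        pComm (xG 0 (Multiplicative.ofAdd a)) (xG 1 (Multiplicative.ofAdd 1))) →
      (∀ a : ℚ, ψ (Monoid.Coprod.inr (Multiplicative.ofAdd a)) =
        pComm (xG 1 (Multiplicative.ofAdd a)) (xG 2 (Multiplicative.ofAdd 1))) →
      Function.Injective ψ) := by
  constructor
  · refine ⟨Monoid.Coprod.lift (KMS.cHom 0 1 (by decide)) (KMS.cHom 1 2 (by decide)), ?_, ?_⟩
    · intro a; simp [KMS.cHom]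
    · intro a; simp [KMS.cHom]
  · intro ψ h1 h2
    have e : KMS.phi.comp ψ = (Monoid.CoprodI.lift KMS.ff).comp KMS.toI := by
      apply Monoid.Coprod.hom_ext
      · refine MonoidHom.ext fun a => ?_
        have := h1 a.toAdd
        simp only [ofAdd_toAdd] at this
        simp only [MonoidHom.comp_apply, this, KMS.pComm_map, KMS.phi_x, KMS.toI,
          Monoid.Coprod.lift_apply_inl, Monoid.CoprodI.lift_of, KMS.ff_false]
        have h3 := KMS.comm_XY false a (.ofAdd 1)
        simp only [KMS.sg] at h3
        refine h3.trans ?_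
        congr 1
        simp
      · refine MonoidHom.ext fun a => ?_
        have := h2 a.toAdd
        simp only [ofAdd_toAdd] at this
        simp only [MonoidHom.comp_apply, this, KMS.pComm_map, KMS.phi_x, KMS.toI,
          Monoid.Coprod.lift_apply_inr, Monoid.CoprodI.lift_of, KMS.ff_true]
        have h3 := KMS.comm_XY false a (.ofAdd 1)
        have h4 : KMS.Sh (-2 * a.toAdd) = pComm (KMS.xP 0 a) (KMS.xP 1 (.ofAdd 1)) := by
          refine Eq.trans ?_ h3.symm
          congr 1
          simp [KMS.sg]
        have h5 := KMS.pComm_map (MulAut.conj KMS.Tp).toMonoidHom (KMS.xP 1 a) (KMS.xP 2 (.ofAdd 1))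
        simp only [MulEquiv.toMonoidHom_eq_coe, MonoidHom.coe_coe] at h5
        have h6 : MulAut.conj KMS.Tp (KMS.xP 1 a) = KMS.xP 0 a := KMS.conj_xP 0 a
        have h7 : MulAut.conj KMS.Tp (KMS.xP 2 (.ofAdd 1)) = KMS.xP 1 (.ofAdd 1) :=
          KMS.conj_xP 1 _
        rw [h4, ← h6, ← h7, ← h5, MulAut.conj_apply]
        group
    have inj : Function.Injective (KMS.phi.comp ψ) := by
      rw [e]
      exact KMS.lift_inj.comp KMS.toI_inj
    intro a b hab
    apply inj
    simp [hab]
end
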